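/- With D defined by D(2)={0}, D(3)=D(4)=D(5)={1}, D(6)={2}, and D(t) = (D(t−3)+1) ∪ (D(t−5)+2) for t ≥ 7, the minimum of D(t) equals ⌊t/3⌋ for all t ≥ 2. -/

import Mathlib

/-- The set of sphere dimensions for the matching complex of `P_{3,t}`:
`D 2 = {0}`, `D 3 = D 4 = D 5 = {1}`, `D 6 = {2}`, and for `t ≥ 7`,
`D t = (D (t−3) + 1) ∪ (D (t−5) + 2)` (elementwise shifts). -/
def D : ℕ → Finset ℕ
  | 2 => {0}
  | 3 => {1}
  | 4 => {1}
  | 5 => {1}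
  | 6 => {2}
  | t + 7 => (D (t + 4)).image (· + 1) ∪ (D (t + 2)).image (· + 2)
  | _ => ∅

theorem div_three_mem_D (t : ℕ) (ht : 2 ≤ t) : t / 3 ∈ D t := by
  induction t using Nat.strong_induction_on with
  | _ t ih =>
    match t, ht with
    | 2, _ | 3, _ | 4, _ | 5, _ | 6, _ => simp [D]
    | t + 7, _ =>
      have h := ih (t + 4) (by omega) (by omega)
      rw [D, Finset.mem_union, Finset.mem_image]
      exact Or.inl ⟨_, h, by omega⟩

theorem div_three_le_of_mem_D (t : ℕ) {d : ℕ} (hd : d ∈ D t) : t / 3 ≤ d := by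
  induction t using Nat.strong_induction_on generalizing d with
  | _ t ih =>
    match t with
    | 0 | 1 | 2 | 3 | 4 | 5 | 6 => simp_all [D]
    | t + 7 =>
      simp only [D, Finset.mem_union, Finset.mem_image] at hd
      rcases hd with ⟨e, he, rfl⟩ | ⟨e, he, rfl⟩
      · have := ih (t + 4) (by omega) he
        omega
      · have := ih (t + 2) (by omega) he
        omega

/-- For every `t ≥ 2`, the minimum of `D t` equals `⌊t/3⌋`. -/
theorem D_min (t : ℕ) (ht : 2 ≤ t) : (D t).min = (t / 3 : ℕ) := by
  apply le_antisymm
  · exact Finset.min_le (div_three_mem_D t ht)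
  · exact Finset.le_min fun d hd => WithTop.coe_le_coe.2 (div_three_le_of_mem_D t hd)
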